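/- arXiv:2405.07961 — 3 statements merged into one kernel-verified Lean document; each statement's English description precedes it below -/
import Mathlib

section
/- If u ∈ ℝ^V satisfies (L(σ)u)|_{∂Ω ∪ Ω⁻} = 0, then 𝒮(γ₁⁺u) − 𝒟⁺(γ₀u) = u·𝟙_{∂Ω ∪ Ω⁻}, where 𝟙_X denotes the indicator vector of X ⊆ V and the product is componentwise. -/
open Matrix BigOperators

noncomputable section

variable {V : Type*} [Fintype V] [DecidableEq V]

/-- Weighted graph Laplacian of a symmetric weight function. -/
def lap (σ : V → V → ℝ) : Matrix V V ℝ :=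
  Matrix.of fun x y => if x = y then ∑ z, σ x z else -σ x y

/-- Restriction matrix `R_X : ℝ^V → ℝ^X`. -/
def restr (X : Finset V) : Matrix {x // x ∈ X} V ℝ :=
  Matrix.of fun i j => if (i : V) = j then 1 else 0

/-- Green function `G = R_{V°}ᵀ (L[V°,V°])⁻¹ R_{V°}` with `V° = Bᶜ`. -/
def green (B : Finset V) (σ : V → V → ℝ) : Matrix V V ℝ :=
  (restr Bᶜ)ᵀ * (restr Bᶜ * lap σ * (restr Bᶜ)ᵀ)⁻¹ * restr Bᶜ

/-- Dirichlet trace operator `γ₀ = R_{∂Ω}`. -/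
def gamma0 (dO : Finset V) : Matrix {x // x ∈ dO} V ℝ := restr dO

/-- Exterior Neumann trace operator `γ₁⁺ = -R_{∂Ω} L(σ⁺)`. -/
def gamma1p (dO : Finset V) (σp : V → V → ℝ) : Matrix {x // x ∈ dO} V ℝ :=
  -(restr dO * lap σp)

/-- Interior Neumann trace operator `γ₁⁻ = R_{∂Ω} L(σ⁻)`. -/
def gamma1m (dO : Finset V) (σm : V → V → ℝ) : Matrix {x // x ∈ dO} V ℝ :=
  restr dO * lap σm

/-- Single layer potential `𝒮 = G γ₀ᵀ`. -/
def slp (B dO : Finset V) (σ : V → V → ℝ) : Matrix V {x // x ∈ dO} ℝ :=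
  green B σ * (gamma0 dO)ᵀ

/-- Exterior double layer potential `𝒟⁺ = G (γ₁⁺)ᵀ`. -/
def dlpP (B dO : Finset V) (σ σp : V → V → ℝ) : Matrix V {x // x ∈ dO} ℝ :=
  green B σ * (gamma1p dO σp)ᵀ

/-- Interior double layer potential `𝒟⁻ = G (γ₁⁻)ᵀ`. -/
def dlpM (B dO : Finset V) (σ σm : V → V → ℝ) : Matrix V {x // x ∈ dO} ℝ :=
  green B σ * (gamma1m dO σm)ᵀ

/-- Single layer boundary operator `S = γ₀ 𝒮`. -/
def Sop (B dO : Finset V) (σ : V → V → ℝ) : Matrix {x // x ∈ dO} {x // x ∈ dO} ℝ :=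
  gamma0 dO * slp B dO σ

/-- Double layer boundary operator `D = ½ γ₀ (𝒟⁺ + 𝒟⁻)`. -/
def Dop (B dO : Finset V) (σ σp σm : V → V → ℝ) : Matrix {x // x ∈ dO} {x // x ∈ dO} ℝ :=
  (1/2 : ℝ) • (gamma0 dO * (dlpP B dO σ σp + dlpM B dO σ σm))

/-- Adjoint double layer (Neumann–Poincaré) operator `D' = ½ (γ₁⁺ + γ₁⁻) 𝒮`. -/
def Dadj (B dO : Finset V) (σ σp σm : V → V → ℝ) : Matrix {x // x ∈ dO} {x // x ∈ dO} ℝ :=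
  (1/2 : ℝ) • ((gamma1p dO σp + gamma1m dO σm) * slp B dO σ)

/-- Hypersingular operator `H = -γ₁⁺ 𝒟⁻`. -/
def Hop (B dO : Finset V) (σ σp σm : V → V → ℝ) : Matrix {x // x ∈ dO} {x // x ∈ dO} ℝ :=
  -(gamma1p dO σp * dlpM B dO σ σm)

/-- Indicator vector of a node subset. -/
def ind (X : Finset V) : V → ℝ := fun x => if x ∈ X then 1 else 0

/-- The subgraph with node set `A` and edges `{x,y}` with `w x y > 0` is connected. -/
def connOn (A : Finset V) (w : V → V → ℝ) : Prop :=
  ∀ x ∈ A, ∀ y ∈ A, Relation.ReflTransGen (fun a b => a ∈ A ∧ b ∈ A ∧ 0 < w a b) x y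

theorem lap_mulVec {V : Type*} [Fintype V] [DecidableEq V] (σ : V → V → ℝ) (v : V → ℝ) (x : V)
    (hσ : σ x x = 0) :
    (lap σ *ᵥ v) x = ∑ y, σ x y * (v x - v y) := by
  simp only [Matrix.mulVec, dotProduct]
  rw [← Finset.add_sum_erase _ _ (Finset.mem_univ x),
    ← Finset.add_sum_erase _ (fun y => σ x y * (v x - v y)) (Finset.mem_univ x)]
  have h : ∑ y ∈ Finset.univ.erase x, lap σ x y * v y
      = -∑ y ∈ Finset.univ.erase x, σ x y * v y := by
    rw [← Finset.sum_neg_distrib]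
    refine Finset.sum_congr rfl fun y hy => ?_
    simp [lap, (Finset.ne_of_mem_erase hy).symm]
  rw [h]
  simp only [lap, Matrix.of_apply, if_true, mul_sub, Finset.sum_sub_distrib, ← Finset.sum_mul,
    sub_self]
  rw [← Finset.add_sum_erase _ (fun z => σ x z) (Finset.mem_univ x), hσ]
  ring

theorem restr_mulVec {V : Type*} [Fintype V] [DecidableEq V] (X : Finset V) (v : V → ℝ)
    (i : {x // x ∈ X}) : (restr X *ᵥ v) i = v i := by
  simp [restr, Matrix.mulVec, dotProduct]

theorem restr_transpose_mulVec_restr {V : Type*} [Fintype V] [DecidableEq V] (X : Finset V)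
    (v : V → ℝ) : (restr X)ᵀ *ᵥ (restr X *ᵥ v) = v * ind X := by
  ext x
  simp only [Matrix.mulVec, dotProduct, Matrix.transpose_apply, restr, Matrix.of_apply,
    ite_mul, one_mul, zero_mul, Finset.sum_ite_eq, Finset.mem_univ, if_true, Pi.mul_apply, ind]
  rw [Finset.sum_coe_sort X (fun i => if i = x then v i else 0)]
  simp

theorem lap_transpose {V : Type*} [Fintype V] [DecidableEq V] (σ : V → V → ℝ)
    (h : ∀ x y, σ x y = σ y x) : (lap σ)ᵀ = lap σ := by
  ext x y
  by_cases hxy : x = y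
  · subst hxy; rfl
  · simp [lap, hxy, Ne.symm hxy, h x y]

/-- The Green function solves the Dirichlet problem: a vector `w` vanishing on `B` is recovered
from the values of its Laplacian outside `B`. -/
theorem green_mulVec_eq {V : Type*} [Fintype V] [DecidableEq V] (B : Finset V) (σ : V → V → ℝ)
    (hpd : (restr Bᶜ * lap σ * (restr Bᶜ)ᵀ).PosDef) (f w : V → ℝ)
    (hw : ∀ x ∈ B, w x = 0) (hf : ∀ x ∉ B, (lap σ *ᵥ w) x = f x) :
    green B σ *ᵥ f = w := by
  have hww : (restr Bᶜ)ᵀ *ᵥ (restr Bᶜ *ᵥ w) = w := by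
    rw [restr_transpose_mulVec_restr]
    ext x
    by_cases hx : x ∈ B <;> simp [ind, hx, hw]
  have hrf : restr Bᶜ *ᵥ f = (restr Bᶜ * lap σ * (restr Bᶜ)ᵀ) *ᵥ (restr Bᶜ *ᵥ w) := by
    rw [← Matrix.mulVec_mulVec, hww, ← Matrix.mulVec_mulVec]
    ext i
    rw [restr_mulVec, restr_mulVec, hf _ (Finset.mem_compl.mp i.2)]
  have hdet := (Matrix.isUnit_iff_isUnit_det _).mp hpd.isUnit
  rw [green, ← Matrix.mulVec_mulVec, hrf, Matrix.mulVec_mulVec, Matrix.mul_assoc _ _⁻¹,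
    Matrix.nonsing_inv_mul _ hdet, Matrix.mul_one, hww]

theorem stmt_1
    {V : Type*} [Fintype V] [DecidableEq V]
    (B Op dO Om : Finset V)
    (hBne : B.Nonempty) (hOpne : Op.Nonempty) (hdOne : dO.Nonempty) (hOmne : Om.Nonempty)
    (hd1 : Disjoint B Op) (hd2 : Disjoint B dO) (hd3 : Disjoint B Om)
    (hd4 : Disjoint Op dO) (hd5 : Disjoint Op Om) (hd6 : Disjoint dO Om)
    (hcover : B ∪ Op ∪ dO ∪ Om = Finset.univ)
    (σ σp σm : V → V → ℝ)
    (hσsymm : ∀ x y, σ x y = σ y x) (hσdiag : ∀ x, σ x x = 0)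
    (hσnn : ∀ x y, 0 ≤ σ x y)
    (hsepBdO : ∀ x ∈ B, ∀ y ∈ dO, σ x y = 0)
    (hsepBOm : ∀ x ∈ B, ∀ y ∈ Om, σ x y = 0)
    (hsepOpOm : ∀ x ∈ Op, ∀ y ∈ Om, σ x y = 0)
    (hσpsymm : ∀ x y, σp x y = σp y x) (hσpdiag : ∀ x, σp x x = 0)
    (hσmsymm : ∀ x y, σm x y = σm y x) (hσmdiag : ∀ x, σm x x = 0)
    (hσpnn : ∀ x y, 0 ≤ σp x y) (hσmnn : ∀ x y, 0 ≤ σm x y)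
    (hsum : ∀ x y, σp x y + σm x y = σ x y)
    (hp1 : ∀ x y, x ∈ B ∪ Op ∨ y ∈ B ∪ Op → σp x y = σ x y)
    (hm1 : ∀ x y, x ∈ Om ∨ y ∈ Om → σm x y = σ x y)
    (hpd : (restr Bᶜ * lap σ * (restr Bᶜ)ᵀ).PosDef) :
    ∀ u : V → ℝ, (∀ x ∈ dO ∪ Om, (lap σ *ᵥ u) x = 0) →
      slp B dO σ *ᵥ (gamma1p dO σp *ᵥ u) - dlpP B dO σ σp *ᵥ (gamma0 dO *ᵥ u)
        = u * ind (dO ∪ Om) := by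
  intro u hu
  have hpm : ∀ x y, σp x y = σ x y - σm x y := fun x y => by linarith [hsum x y]
  have hlhs : slp B dO σ *ᵥ (gamma1p dO σp *ᵥ u) - dlpP B dO σ σp *ᵥ (gamma0 dO *ᵥ u)
      = green B σ *ᵥ (lap σp *ᵥ (u * ind dO) - (lap σp *ᵥ u) * ind dO) := by
    rw [slp, dlpP, gamma1p, gamma0, Matrix.transpose_neg, Matrix.transpose_mul,
      lap_transpose σp hσpsymm, ← restr_transpose_mulVec_restr,
      ← restr_transpose_mulVec_restr]
    simp only [Matrix.mulVec_mulVec, Matrix.mulVec_sub, Matrix.mul_neg, Matrix.neg_mul,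
      Matrix.neg_mulVec, Matrix.mulVec_neg, Matrix.mul_assoc]
    abel
  rw [hlhs]
  refine green_mulVec_eq B σ hpd _ _ (fun x hx => ?_) fun x hx => ?_
  · simp [ind, Finset.disjoint_left.mp hd2 hx, Finset.disjoint_left.mp hd3 hx]
  have hcov : ∀ y, y ∈ B ∨ y ∈ Op ∨ y ∈ dO ∨ y ∈ Om := fun y => by
    have := Finset.mem_univ y
    rw [← hcover] at this
    simpa [or_assoc] using this
  have hσBO : ∀ y, y ∉ dO ∪ Om → y ∈ B ∪ Op := fun y hy => by
    have := hcov y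
    simp only [Finset.mem_union] at hy ⊢
    tauto
  have hxOp : x ∈ Op ∨ x ∈ dO ∨ x ∈ Om := (hcov x).resolve_left hx
  rcases hxOp with h | h | h
  · have h1 := Finset.disjoint_left.mp hd4 h
    have h2 := Finset.disjoint_left.mp hd5 h
    simp only [Pi.sub_apply, Pi.mul_apply, lap_mulVec _ _ _ (hσdiag x),
      lap_mulVec _ _ _ (hσpdiag x), ind, Finset.mem_union, h1, h2, or_self, if_false, mul_zero,
      sub_zero]
    refine Finset.sum_congr rfl fun y _ => ?_
    rw [hp1 x y (Or.inl (Finset.mem_union_right _ h))]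
    by_cases hy : y ∈ Om
    · simp [hsepOpOm x h y hy]
    · simp [hy]
  · rw [← sub_zero ((lap σ *ᵥ _) x), ← hu x (Finset.mem_union_left _ h)]
    simp only [Pi.sub_apply, Pi.mul_apply, lap_mulVec _ _ _ (hσdiag x),
      lap_mulVec _ _ _ (hσpdiag x), ind, Finset.mem_union, h, true_or, if_true, mul_one,
      ← Finset.sum_sub_distrib]
    refine Finset.sum_congr rfl fun y _ => ?_
    by_cases hy : y ∈ dO
    · simp [hy]
    by_cases hy' : y ∈ Om
    · simp [hy', hpm, hm1 x y (Or.inr hy')]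
    · rw [hp1 x y (Or.inr (hσBO y (by simp [hy, hy'])))]
      simp [hy, hy']
  · have h1 := Finset.disjoint_right.mp hd6 h
    have h0 : ∀ y, σp x y = 0 := fun y => by rw [hpm, hm1 x y (Or.inl h), sub_self]
    rw [← sub_zero ((lap σ *ᵥ _) x), ← hu x (Finset.mem_union_right _ h)]
    simp only [Pi.sub_apply, Pi.mul_apply, lap_mulVec _ _ _ (hσdiag x),
      lap_mulVec _ _ _ (hσpdiag x), h0, zero_mul, Finset.sum_const_zero, sub_self,
      ← Finset.sum_sub_distrib]
    refine Finset.sum_eq_zero fun y _ => ?_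
    by_cases hy : y ∈ dO ∪ Om
    · simp [ind, h, Finset.mem_union.mp hy]
    · have hxy : σ x y = 0 := by
        rw [hσsymm]
        rcases Finset.mem_union.mp (hσBO y hy) with hB | hO
        · exact hsepBOm y hB x h
        · exact hsepOpOm y hO x h
      simp [hxy]
end
end

section
/- The jump relations γ₁⁺𝒮 = −I/2 + D' and γ₁⁻𝒮 = I/2 + D' hold, where I is the ∂Ω×∂Ω identity matrix. -/
open Matrix BigOperators

noncomputable section

variable {V : Type*} [Fintype V] [DecidableEq V]

theorem restr_mul_apply {n : Type*} (X : Finset V) (M : Matrix V n ℝ) (i : {x // x ∈ X}) (j : n) :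
    (restr X * M) i j = M i j := by
  simp [Matrix.mul_apply, restr]

theorem restr_mul_transpose_restr (X : Finset V) : restr X * (restr X)ᵀ = 1 := by
  ext i j
  rw [restr_mul_apply]
  by_cases h : i = j
  · simp [restr, Matrix.one_apply, h]
  · simp [restr, h, Ne.symm h]

/-- Restricting to a subset factors through restricting to the larger set. -/
theorem restr_eq_mul_restr {X Y : Finset V} (h : X ⊆ Y) :
    restr X = restr X * (restr Y)ᵀ * restr Y := by
  ext i j
  have hi : (i : V) ∈ Y := h i.2
  rw [Matrix.mul_assoc, restr_mul_apply, Matrix.mul_apply,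
    Finset.sum_eq_single (⟨i, hi⟩ : {x // x ∈ Y})]
  · simp [restr]
  · intro b _ hb
    have : (b : V) ≠ i := fun e => hb (Subtype.ext e)
    simp [restr, this]
  · simp

/-- On the complement of `B`, the Green function is a right inverse of the Laplacian. -/
theorem restr_mul_lap_mul_green {B X : Finset V} {σ : V → V → ℝ} (h : X ⊆ Bᶜ)
    (hdet : IsUnit (restr Bᶜ * lap σ * (restr Bᶜ)ᵀ).det) :
    restr X * lap σ * green B σ = restr X := by
  calc restr X * lap σ * green B σ
      = restr X * (restr Bᶜ)ᵀ * ((restr Bᶜ * lap σ * (restr Bᶜ)ᵀ) *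
          (restr Bᶜ * lap σ * (restr Bᶜ)ᵀ)⁻¹) * restr Bᶜ := by
        conv_lhs => rw [restr_eq_mul_restr h]
        simp only [green, Matrix.mul_assoc]
    _ = restr X := by
        rw [Matrix.mul_nonsing_inv _ hdet, Matrix.mul_one, ← restr_eq_mul_restr h]

theorem lap_add (σ τ : V → V → ℝ) : lap (σ + τ) = lap σ + lap τ := by
  ext x y
  by_cases h : x = y
  · simp [lap, h, Finset.sum_add_distrib]
  · simp [lap, h, add_comm]

/-- The two Neumann traces of the single layer potential jump by the identity. -/
theorem gamma1m_sub_gamma1p_mul_slp {B X : Finset V} {σ σp σm : V → V → ℝ} (h : X ⊆ Bᶜ)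
    (hsum : σp + σm = σ) (hdet : IsUnit (restr Bᶜ * lap σ * (restr Bᶜ)ᵀ).det) :
    gamma1m X σm * slp B X σ - gamma1p X σp * slp B X σ = 1 := by
  have hγ : gamma1m X σm - gamma1p X σp = restr X * lap σ := by
    rw [gamma1m, gamma1p, sub_neg_eq_add, ← Matrix.mul_add, add_comm, ← lap_add, hsum]
  rw [← Matrix.sub_mul, hγ, slp, gamma0, ← Matrix.mul_assoc, restr_mul_lap_mul_green h hdet,
    restr_mul_transpose_restr]

theorem stmt_5
    {V : Type*} [Fintype V] [DecidableEq V]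
    (B Op dO Om : Finset V)
    (hBne : B.Nonempty) (hOpne : Op.Nonempty) (hdOne : dO.Nonempty) (hOmne : Om.Nonempty)
    (hd1 : Disjoint B Op) (hd2 : Disjoint B dO) (hd3 : Disjoint B Om)
    (hd4 : Disjoint Op dO) (hd5 : Disjoint Op Om) (hd6 : Disjoint dO Om)
    (hcover : B ∪ Op ∪ dO ∪ Om = Finset.univ)
    (σ σp σm : V → V → ℝ)
    (hσsymm : ∀ x y, σ x y = σ y x) (hσdiag : ∀ x, σ x x = 0)
    (hσnn : ∀ x y, 0 ≤ σ x y)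
    (hsepBdO : ∀ x ∈ B, ∀ y ∈ dO, σ x y = 0)
    (hsepBOm : ∀ x ∈ B, ∀ y ∈ Om, σ x y = 0)
    (hsepOpOm : ∀ x ∈ Op, ∀ y ∈ Om, σ x y = 0)
    (hσpsymm : ∀ x y, σp x y = σp y x) (hσpdiag : ∀ x, σp x x = 0)
    (hσmsymm : ∀ x y, σm x y = σm y x) (hσmdiag : ∀ x, σm x x = 0)
    (hσpnn : ∀ x y, 0 ≤ σp x y) (hσmnn : ∀ x y, 0 ≤ σm x y)
    (hsum : ∀ x y, σp x y + σm x y = σ x y)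
    (hp1 : ∀ x y, x ∈ B ∪ Op ∨ y ∈ B ∪ Op → σp x y = σ x y)
    (hm1 : ∀ x y, x ∈ Om ∨ y ∈ Om → σm x y = σ x y)
    (hpd : (restr Bᶜ * lap σ * (restr Bᶜ)ᵀ).PosDef) :
    gamma1p dO σp * slp B dO σ = (-(1/2) : ℝ) • (1 : Matrix {x // x ∈ dO} {x // x ∈ dO} ℝ) + Dadj B dO σ σp σm
    ∧ gamma1m dO σm * slp B dO σ = ((1/2) : ℝ) • (1 : Matrix {x // x ∈ dO} {x // x ∈ dO} ℝ) + Dadj B dO σ σp σm := by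
  have hjump := gamma1m_sub_gamma1p_mul_slp (X := dO) (σ := σ) (σp := σp) (σm := σm)
    (Finset.subset_compl_iff_disjoint_left.mpr hd2) (funext₂ hsum)
    ((Matrix.isUnit_iff_isUnit_det _).mp hpd.isUnit)
  rw [Dadj, Matrix.add_mul, ← hjump]
  constructor <;> module
end
end

section
/- The single layer boundary operator S = γ₀ G γ₀ᵀ is a symmetric positive definite matrix (in particular invertible) and all of its entries are nonnegative. -/
open Matrix BigOperators

noncomputable section

variable {V : Type*} [Fintype V] [DecidableEq V]

/-- A positive definite matrix with nonpositive off-diagonal entries satisfies the maximum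
principle: `M u ≥ 0` implies `u ≥ 0`. -/
theorem Matrix.PosDef.nonneg_of_mulVec_nonneg {n : Type*} [Fintype n] {M : Matrix n n ℝ}
    (hM : M.PosDef) (hoff : ∀ i j, i ≠ j → M i j ≤ 0) {u : n → ℝ} (hu : 0 ≤ M *ᵥ u) :
    0 ≤ u := by
  have hsplit : u = u⁺ - u⁻ := (posPart_sub_negPart u).symm
  have hcross : u⁻ ⬝ᵥ (M *ᵥ u⁺) ≤ 0 := by
    simp only [dotProduct, mulVec, Finset.mul_sum]
    refine Finset.sum_nonpos fun i _ => Finset.sum_nonpos fun j _ => ?_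
    have hi : 0 ≤ u⁻ i := negPart_nonneg u i
    have hj : 0 ≤ u⁺ j := posPart_nonneg u j
    by_cases hij : i = j
    · subst hij
      have : u⁻ i * u⁺ i = 0 := by
        rw [Pi.negPart_apply, Pi.posPart_apply]
        rcases le_total 0 (u i) with h | h
        · rw [negPart_eq_zero.2 h, zero_mul]
        · rw [posPart_eq_zero.2 h, mul_zero]
      rw [mul_left_comm, this, mul_zero]
    · exact mul_nonpos_of_nonneg_of_nonpos hi
        (mul_nonpos_of_nonpos_of_nonneg (hoff i j hij) hj)
  have hnonneg : 0 ≤ u⁻ ⬝ᵥ (M *ᵥ u) := dotProduct_nonneg_of_nonneg (negPart_nonneg u) hu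
  rw [hsplit, mulVec_sub, ← hsplit, dotProduct_sub] at hnonneg
  have hzero : u⁻ = 0 := by
    by_contra hne
    have hpos := hM.dotProduct_mulVec_pos hne
    rw [star_trivial] at hpos
    linarith
  exact negPart_eq_zero.1 hzero

/-- A positive definite matrix with nonpositive off-diagonal entries has an entrywise nonnegative
inverse. -/
theorem Matrix.PosDef.inv_apply_nonneg {n : Type*} [Fintype n] [DecidableEq n]
    {M : Matrix n n ℝ} (hM : M.PosDef) (hoff : ∀ i j, i ≠ j → M i j ≤ 0) (i j : n) :
    0 ≤ M⁻¹ i j := by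
  have hu : 0 ≤ M *ᵥ (M⁻¹).col j := by
    rw [← mulVec_single_one, mulVec_mulVec,
      Matrix.mul_nonsing_inv _ ((Matrix.isUnit_iff_isUnit_det M).1 hM.isUnit), one_mulVec]
    exact Pi.single_nonneg.2 zero_le_one
  exact hM.nonneg_of_mulVec_nonneg hoff hu i

theorem restr_mul_mul_restr_transpose (X : Finset V) (A : Matrix V V ℝ) :
    restr X * A * (restr X)ᵀ = A.submatrix Subtype.val Subtype.val := by
  ext i j
  simp [restr, Matrix.mul_apply]

theorem restr_mul_restr_transpose {X Y : Finset V} (h : X ⊆ Y) :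
    restr X * (restr Y)ᵀ =
      (1 : Matrix {x // x ∈ Y} {x // x ∈ Y} ℝ).submatrix (fun x : {x // x ∈ X} => ⟨x, h x.2⟩) id := by
  ext i j
  simp [restr, Matrix.mul_apply, Matrix.one_apply, Subtype.ext_iff, eq_comm]

/-- The single layer boundary operator is a principal submatrix of `L[V°,V°]⁻¹`. -/
theorem Sop_eq_submatrix {B dO : Finset V} (h : dO ⊆ Bᶜ) (σ : V → V → ℝ) :
    Sop B dO σ = (restr Bᶜ * lap σ * (restr Bᶜ)ᵀ)⁻¹.submatrix
      (fun x : {x // x ∈ dO} => ⟨x, h x.2⟩) (fun x : {x // x ∈ dO} => ⟨x, h x.2⟩) := by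
  have hT : restr Bᶜ * (restr dO)ᵀ = (restr dO * (restr Bᶜ)ᵀ)ᵀ := by
    rw [transpose_mul, transpose_transpose]
  calc Sop B dO σ = (restr dO * (restr Bᶜ)ᵀ) * (restr Bᶜ * lap σ * (restr Bᶜ)ᵀ)⁻¹ *
        (restr Bᶜ * (restr dO)ᵀ) := by
        simp only [Sop, slp, green, gamma0, Matrix.mul_assoc]
    _ = _ := by
        rw [hT, restr_mul_restr_transpose h]
        ext i j
        simp [Matrix.mul_apply, Matrix.one_apply]

theorem stmt_10
    {V : Type*} [Fintype V] [DecidableEq V]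
    (B Op dO Om : Finset V)
    (hBne : B.Nonempty) (hOpne : Op.Nonempty) (hdOne : dO.Nonempty) (hOmne : Om.Nonempty)
    (hd1 : Disjoint B Op) (hd2 : Disjoint B dO) (hd3 : Disjoint B Om)
    (hd4 : Disjoint Op dO) (hd5 : Disjoint Op Om) (hd6 : Disjoint dO Om)
    (hcover : B ∪ Op ∪ dO ∪ Om = Finset.univ)
    (σ : V → V → ℝ)
    (hσsymm : ∀ x y, σ x y = σ y x) (hσdiag : ∀ x, σ x x = 0)
    (hσnn : ∀ x y, 0 ≤ σ x y)
    (hsepBdO : ∀ x ∈ B, ∀ y ∈ dO, σ x y = 0)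
    (hsepBOm : ∀ x ∈ B, ∀ y ∈ Om, σ x y = 0)
    (hsepOpOm : ∀ x ∈ Op, ∀ y ∈ Om, σ x y = 0)
    (hpd : (restr Bᶜ * lap σ * (restr Bᶜ)ᵀ).PosDef) :
    (Sop B dO σ).PosDef ∧ IsUnit (Sop B dO σ).det ∧ ∀ i j, 0 ≤ Sop B dO σ i j := by
  have hsub : dO ⊆ Bᶜ := Finset.subset_compl_iff_disjoint_left.2 hd2
  have hS : (Sop B dO σ).PosDef := by
    rw [Sop_eq_submatrix hsub]
    exact hpd.inv.submatrix fun x y hxy => Subtype.ext (congrArg Subtype.val hxy :)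
  refine ⟨hS, (Matrix.isUnit_iff_isUnit_det _).1 hS.isUnit, fun i j => ?_⟩
  rw [Sop_eq_submatrix hsub]
  refine hpd.inv_apply_nonneg (fun x y hxy => ?_) _ _
  rw [restr_mul_mul_restr_transpose]
  simp [lap, Subtype.coe_injective.ne hxy, hσnn]
end
end
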